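/- Let g : ℝⁿ → ℝ be twice continuously differentiable with g, ∇g, and ∇²g of at most polynomial growth, let Λ be an invertible n×n real matrix, and let y ∈ ℝⁿ. Then ∫_{ℝⁿ} g(Λx + y) · (x xᵀ − I) dγₙ(x) = Λᵀ · (∫_{ℝⁿ} ∇²g(Λx + y) dγₙ(x)) · Λ. Equivalently, if z is distributed as the Gaussian N(y, ΛΛᵀ), then E[g(z) · (Λ^{−1}(z − y)(z − y)ᵀΛ^{−⊤} − I)] = Λᵀ · E[∇²g(z)] · Λ. -/

import Mathlib

open MeasureTheory Real Matrix

attribute [local instance] Matrix.normedAddCommGroup Matrix.normedSpace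

/-- The standard Gaussian measure on `ℝⁿ`, with density `(2π)^{−n/2} exp(−‖x‖²/2)` with
respect to Lebesgue measure. -/
noncomputable def stdGaussian (n : ℕ) : Measure (EuclideanSpace ℝ (Fin n)) :=
  volume.withDensity fun x =>
    ENNReal.ofReal ((2 * π) ^ (-(n : ℝ) / 2) * Real.exp (-‖x‖ ^ 2 / 2))

/-- A function has at most polynomial growth if `‖f(x)‖ ≤ C(1 + ‖x‖)^r` for some `C > 0`
and some natural number `r`. -/
def PolyGrowth {E F : Type*} [NormedAddCommGroup E] [NormedAddCommGroup F] (f : E → F) : Prop :=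
  ∃ C > (0 : ℝ), ∃ r : ℕ, ∀ x, ‖f x‖ ≤ C * (1 + ‖x‖) ^ r

/-- The Hessian matrix `(∇²g(x))_{ij} = ∂²g/∂xᵢ∂xⱼ (x)` of `g : ℝⁿ → ℝ`. -/
noncomputable def hessian {n : ℕ} (g : EuclideanSpace ℝ (Fin n) → ℝ)
    (x : EuclideanSpace ℝ (Fin n)) : Matrix (Fin n) (Fin n) ℝ :=
  Matrix.of fun i j =>
    fderiv ℝ (fun z => fderiv ℝ g z (EuclideanSpace.single j 1)) x (EuclideanSpace.single i 1)

namespace PolyGrowth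

variable {E F G : Type*} [NormedAddCommGroup E] [NormedAddCommGroup F] [NormedAddCommGroup G]

lemma of_norm_le_mul {f : E → F} {h : E → G} (hh : PolyGrowth h) (K : ℝ)
    (hle : ∀ x, ‖f x‖ ≤ K * ‖h x‖) : PolyGrowth f := by
  obtain ⟨C, hC, r, hr⟩ := hh
  refine ⟨(|K| + 1) * C, by positivity, r, fun x => (hle x).trans ?_⟩
  calc K * ‖h x‖ ≤ (|K| + 1) * (C * (1 + ‖x‖) ^ r) := by
        gcongr
        · linarith [le_abs_self K]
        · exact hr x
    _ = (|K| + 1) * C * (1 + ‖x‖) ^ r := by ring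

lemma id : PolyGrowth (fun x : E => x) :=
  ⟨1, one_pos, 1, fun x => by simp⟩

lemma mul {f h : E → ℝ} (hf : PolyGrowth f) (hh : PolyGrowth h) :
    PolyGrowth (fun x => f x * h x) := by
  obtain ⟨C, hC, r, hr⟩ := hf
  obtain ⟨D, hD, s, hs⟩ := hh
  refine ⟨C * D, by positivity, r + s, fun x => ?_⟩
  calc ‖f x * h x‖ = ‖f x‖ * ‖h x‖ := norm_mul _ _
    _ ≤ (C * (1 + ‖x‖) ^ r) * (D * (1 + ‖x‖) ^ s) := by
        gcongr
        · exact hr x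
        · exact hs x
    _ = C * D * (1 + ‖x‖) ^ (r + s) := by ring

lemma comp_affine [NormedSpace ℝ E] {f : E → F} (hf : PolyGrowth f) (A : E →L[ℝ] E) (y : E) :
    PolyGrowth (fun x => f (A x + y)) := by
  obtain ⟨C, hC, r, hr⟩ := hf
  refine ⟨C * (1 + ‖A‖ + ‖y‖) ^ r, by positivity, r, fun x => (hr _).trans ?_⟩
  rw [mul_assoc, ← mul_pow]
  gcongr
  have h₁ : ‖A x + y‖ ≤ ‖A‖ * ‖x‖ + ‖y‖ := (norm_add_le _ _).trans (by gcongr; exact A.le_opNorm x)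
  nlinarith [norm_nonneg x, norm_nonneg y, norm_nonneg A,
    mul_nonneg (norm_nonneg y) (norm_nonneg x)]

end PolyGrowth

section Gaussian

variable {n : ℕ}

/-- The density of `stdGaussian n` with respect to Lebesgue measure. -/
noncomputable def stdGaussianDensity (n : ℕ) (x : EuclideanSpace ℝ (Fin n)) : ℝ :=
  (2 * π) ^ (-(n : ℝ) / 2) * Real.exp (-‖x‖ ^ 2 / 2)

lemma stdGaussianDensity_nonneg (x : EuclideanSpace ℝ (Fin n)) : 0 ≤ stdGaussianDensity n x := by
  unfold stdGaussianDensity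
  positivity

lemma continuous_stdGaussianDensity : Continuous (stdGaussianDensity n) := by
  unfold stdGaussianDensity
  fun_prop

lemma hasFDerivAt_stdGaussianDensity (x : EuclideanSpace ℝ (Fin n)) :
    HasFDerivAt (stdGaussianDensity n) (-stdGaussianDensity n x • innerSL ℝ x) x := by
  have h := (((hasStrictFDerivAt_norm_sq x).hasFDerivAt.neg.mul_const (1 / 2 : ℝ)).exp).const_mul
    ((2 * π) ^ (-(n : ℝ) / 2))
  have e : stdGaussianDensity n =
      fun x => (2 * π) ^ (-(n : ℝ) / 2) * Real.exp (-‖x‖ ^ 2 * (1 / 2)) := by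
    funext x
    simp only [stdGaussianDensity, div_eq_mul_inv, one_mul]
  rw [e]
  refine h.congr_fderiv ?_
  ext v
  simp
  ring

lemma integrable_stdGaussian_iff {F : Type*} [NormedAddCommGroup F] [NormedSpace ℝ F]
    {f : EuclideanSpace ℝ (Fin n) → F} :
    Integrable f (stdGaussian n) ↔ Integrable (fun x => stdGaussianDensity n x • f x) := by
  have h := integrable_withDensity_iff_integrable_smul' (μ := volume) (g := f)
    (continuous_stdGaussianDensity (n := n)).measurable.ennreal_ofReal
    (Filter.Eventually.of_forall fun x => ENNReal.ofReal_lt_top)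
  simp only [ENNReal.toReal_ofReal (stdGaussianDensity_nonneg _)] at h
  exact h

lemma integral_stdGaussian {F : Type*} [NormedAddCommGroup F] [NormedSpace ℝ F]
    (f : EuclideanSpace ℝ (Fin n) → F) :
    ∫ x, f x ∂(stdGaussian n) = ∫ x, stdGaussianDensity n x • f x := by
  have h := integral_withDensity_eq_integral_toReal_smul (μ := volume)
    (continuous_stdGaussianDensity (n := n)).measurable.ennreal_ofReal
    (Filter.Eventually.of_forall fun x => ENNReal.ofReal_lt_top) f
  simp only [ENNReal.toReal_ofReal (stdGaussianDensity_nonneg _)] at h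
  exact h

lemma one_add_pow_mul_exp_neg_sq_le (r : ℕ) {t : ℝ} (ht : 0 ≤ t) :
    (1 + t) ^ r * Real.exp (-t ^ 2 / 2) ≤
      (r.factorial * Real.exp 2) * Real.exp (-(1 / 4) * t ^ 2) := by
  have h := Real.pow_div_factorial_le_exp (x := 1 + t) (by positivity) r
  rw [div_le_iff₀ (by positivity)] at h
  calc (1 + t) ^ r * Real.exp (-t ^ 2 / 2)
      ≤ (Real.exp (1 + t) * r.factorial) * Real.exp (-t ^ 2 / 2) := by gcongr
    _ = r.factorial * Real.exp (1 + t + -t ^ 2 / 2) := by rw [Real.exp_add (1 + t)]; ring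
    _ ≤ r.factorial * Real.exp (2 + -(1 / 4) * t ^ 2) := by
        refine mul_le_mul_of_nonneg_left (Real.exp_le_exp.2 ?_) (by positivity)
        nlinarith [sq_nonneg (t - 2)]
    _ = _ := by rw [Real.exp_add 2]; ring

lemma PolyGrowth.integrable_stdGaussian {F : Type*} [NormedAddCommGroup F] [NormedSpace ℝ F]
    {f : EuclideanSpace ℝ (Fin n) → F} (hf : PolyGrowth f) (hc : Continuous f) :
    Integrable f (stdGaussian n) := by
  obtain ⟨C, hC, r, hr⟩ := hf
  have hexp : Integrable fun x : EuclideanSpace ℝ (Fin n) => Real.exp (-(1 / 4) * ‖x‖ ^ 2) := by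
    have h := (GaussianFourier.integrable_cexp_neg_mul_sq_norm_add (b := (1 / 4 : ℝ))
      (by norm_num) 0 (0 : EuclideanSpace ℝ (Fin n))).norm
    refine h.congr (Filter.Eventually.of_forall fun x => ?_)
    simp only [Complex.norm_exp]
    congr 1
    rw [← Complex.ofReal_pow, ← Complex.ofReal_neg, zero_mul, add_zero, ← Complex.ofReal_mul,
      Complex.ofReal_re]
  rw [integrable_stdGaussian_iff]
  refine (hexp.const_mul ((2 * π) ^ (-(n : ℝ) / 2) * C * (r.factorial * Real.exp 2))).mono'
    (continuous_stdGaussianDensity.smul hc).aestronglyMeasurable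
    (Filter.Eventually.of_forall fun x => ?_)
  rw [norm_smul, Real.norm_of_nonneg (stdGaussianDensity_nonneg x)]
  calc stdGaussianDensity n x * ‖f x‖
      ≤ stdGaussianDensity n x * (C * (1 + ‖x‖) ^ r) := by
        gcongr
        · exact stdGaussianDensity_nonneg x
        · exact hr x
    _ = (2 * π) ^ (-(n : ℝ) / 2) * C * ((1 + ‖x‖) ^ r * Real.exp (-‖x‖ ^ 2 / 2)) := by
        rw [stdGaussianDensity]; ring
    _ ≤ (2 * π) ^ (-(n : ℝ) / 2) * C *
          ((r.factorial * Real.exp 2) * Real.exp (-(1 / 4) * ‖x‖ ^ 2)) := by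
        refine mul_le_mul_of_nonneg_left ?_ (by positivity)
        exact one_add_pow_mul_exp_neg_sq_le r (norm_nonneg x)
    _ = _ := by ring

/-- **Stein's identity**: Gaussian integration by parts in the direction `v`. -/
lemma integral_mul_inner_stdGaussian {f : EuclideanSpace ℝ (Fin n) → ℝ}
    {f' : EuclideanSpace ℝ (Fin n) → EuclideanSpace ℝ (Fin n) →L[ℝ] ℝ}
    (v : EuclideanSpace ℝ (Fin n)) (hd : ∀ x, HasFDerivAt f (f' x) x)
    (hf : Integrable f (stdGaussian n))
    (hfv : Integrable (fun x => f x * inner ℝ x v) (stdGaussian n))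
    (hf' : Integrable (fun x => f' x v) (stdGaussian n)) :
    ∫ x, f x * inner ℝ x v ∂(stdGaussian n) = ∫ x, f' x v ∂(stdGaussian n) := by
  rw [integrable_stdGaussian_iff] at hf hfv hf'
  rw [integral_stdGaussian, integral_stdGaussian]
  have h := integral_bilinear_hasFDerivAt_right_eq_neg_left_of_integrable (μ := volume)
    (B := ContinuousLinearMap.mul ℝ ℝ) (v := v) (f := stdGaussianDensity n) (g := f) (g' := f')
    (f' := fun x => -stdGaussianDensity n x • innerSL ℝ x)
    (by
      refine hfv.neg.congr (Filter.Eventually.of_forall fun x => ?_)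
      simp
      ring)
    hf' hf
    (fun x _ => hasFDerivAt_stdGaussianDensity x) (fun x _ => hd x)
  simp only [ContinuousLinearMap.mul_apply'] at h
  simp only [smul_eq_mul]
  rw [h, ← integral_neg]
  refine integral_congr_ae (Filter.Eventually.of_forall fun x => ?_)
  simp
  ring

lemma hessian_apply {g : EuclideanSpace ℝ (Fin n) → ℝ} (hg : ContDiff ℝ 2 g)
    (x : EuclideanSpace ℝ (Fin n)) (i j : Fin n) :
    hessian g x i j =
      fderiv ℝ (fderiv ℝ g) x (EuclideanSpace.single i 1) (EuclideanSpace.single j 1) := by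
  have h : DifferentiableAt ℝ (fderiv ℝ g) x :=
    (hg.fderiv_right (m := 1) (by norm_num)).differentiable (by norm_num) x
  simp [hessian, fderiv_clm_apply h (differentiableAt_const _)]

lemma toEuclideanLin_single (Λ : Matrix (Fin n) (Fin n) ℝ) (i : Fin n) :
    Matrix.toEuclideanLin Λ (EuclideanSpace.single i 1) =
      ∑ k, Λ k i • EuclideanSpace.single k (1 : ℝ) := by
  ext l
  simp [Finset.sum_apply, Pi.single_apply]

lemma fderiv_fderiv_toEuclideanLin_single {g : EuclideanSpace ℝ (Fin n) → ℝ}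
    (hg : ContDiff ℝ 2 g) (Λ : Matrix (Fin n) (Fin n) ℝ) (x : EuclideanSpace ℝ (Fin n))
    (i j : Fin n) :
    fderiv ℝ (fderiv ℝ g) x (Matrix.toEuclideanLin Λ (EuclideanSpace.single i 1))
        (Matrix.toEuclideanLin Λ (EuclideanSpace.single j 1)) =
      (Λᵀ * hessian g x * Λ) i j := by
  simp only [toEuclideanLin_single, map_sum, map_smul, _root_.sum_apply,
    _root_.smul_apply, ← hessian_apply hg, Matrix.mul_apply, Matrix.transpose_apply,
    Finset.mul_sum, Finset.sum_mul, smul_eq_mul]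
  refine Finset.sum_congr rfl fun k _ => Finset.sum_congr rfl fun l _ => ?_
  ring

lemma integral_matrix_apply {α : Type*} [MeasurableSpace α] {μ : Measure α}
    {M : α → Matrix (Fin n) (Fin n) ℝ} (hM : ∀ i j, Integrable (fun x => M x i j) μ)
    (i j : Fin n) : (∫ x, M x ∂μ) i j = ∫ x, M x i j ∂μ := by
  have h₁ : (∫ x, M x ∂μ) i = ∫ x, M x i ∂μ :=
    eval_integral (f := fun x i => M x i) (fun i => Integrable.of_eval (hM i)) i
  rw [h₁]
  exact eval_integral (hM i) j

end Gaussian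

/-- Second-order Gaussian integration by parts for an affine change of variables: if `z` is
distributed as `N(y, ΛΛᵀ)`, i.e. `z = Λx + y` with `x` standard Gaussian, then
`∫ g(Λx + y)·(x xᵀ − I) dγₙ(x) = Λᵀ · (∫ ∇²g(Λx + y) dγₙ(x)) · Λ`. -/
theorem secondOrder_fourierHermite_coefficient_affine (n : ℕ)
    (g : EuclideanSpace ℝ (Fin n) → ℝ) (hg : ContDiff ℝ 2 g)
    (hgrow : PolyGrowth g) (hgrow' : PolyGrowth (gradient g))
    (hgrow'' : PolyGrowth (hessian g))
    (Λ : Matrix (Fin n) (Fin n) ℝ) (hΛ : IsUnit Λ.det) (y : EuclideanSpace ℝ (Fin n)) :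
    ∫ x, g (Matrix.toEuclideanLin Λ x + y) •
          ((Matrix.of fun i j => x i * x j) - (1 : Matrix (Fin n) (Fin n) ℝ))
        ∂(stdGaussian n)
      = Λᵀ * (∫ x, hessian g (Matrix.toEuclideanLin Λ x + y) ∂(stdGaussian n)) * Λ := by
  set A : EuclideanSpace ℝ (Fin n) →L[ℝ] EuclideanSpace ℝ (Fin n) :=
    (Matrix.toEuclideanLin Λ).toContinuousLinearMap
  let e : Fin n → EuclideanSpace ℝ (Fin n) := fun i => EuclideanSpace.single i 1
  change ∫ x, g (A x + y) • _ ∂_ = Λᵀ * (∫ x, hessian g (A x + y) ∂_) * Λ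
  have hinner (x : EuclideanSpace ℝ (Fin n)) (i : Fin n) : inner ℝ x (e i) = x i := by
    simp [e, EuclideanSpace.inner_single_right]
  have hdg : ContDiff ℝ 1 (fderiv ℝ g) := hg.fderiv_right (by norm_num)
  have hcg : Continuous fun x => g (A x + y) := hg.continuous.comp (by fun_prop)
  have hcdg (v) : Continuous fun x => fderiv ℝ g (A x + y) v :=
    (hdg.continuous.comp (by fun_prop)).clm_apply continuous_const
  have hcddg (v w) : Continuous fun x => fderiv ℝ (fderiv ℝ g) (A x + y) v w :=
    (((hdg.continuous_fderiv (by norm_num)).comp (by fun_prop)).clm_apply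
      continuous_const).clm_apply continuous_const
  have hpg : PolyGrowth fun x => g (A x + y) := hgrow.comp_affine A y
  have hpdg (v) : PolyGrowth fun x => fderiv ℝ g (A x + y) v := by
    refine (hgrow'.comp_affine A y).of_norm_le_mul ‖v‖ fun x => ?_
    rw [← inner_gradient_left, mul_comm]
    exact norm_inner_le_norm _ _
  have hpx (i : Fin n) : PolyGrowth fun x : EuclideanSpace ℝ (Fin n) => x i :=
    PolyGrowth.id.of_norm_le_mul 1 fun x => by
      rw [one_mul]
      exact PiLp.norm_apply_le x i
  have hHess (i j : Fin n) :
      Integrable (fun x => hessian g (A x + y) i j) (stdGaussian n) := by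
    refine ((hgrow''.comp_affine A y).of_norm_le_mul 1 fun x => ?_).integrable_stdGaussian ?_
    · rw [one_mul]
      exact Matrix.norm_entry_le_entrywise_sup_norm _
    · simp only [hessian_apply hg]
      exact hcddg _ _
  have hgx (i j : Fin n) :
      Integrable (fun x => g (A x + y) * x i * x j) (stdGaussian n) :=
    ((hpg.mul (hpx i)).mul (hpx j)).integrable_stdGaussian (by fun_prop)
  have hgi : Integrable (fun x => g (A x + y)) (stdGaussian n) := hpg.integrable_stdGaussian hcg
  have hdx (v) (i : Fin n) :
      Integrable (fun x => fderiv ℝ g (A x + y) v * x i) (stdGaussian n) :=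
    ((hpdg v).mul (hpx i)).integrable_stdGaussian ((hcdg v).mul (by fun_prop))
  have haff (x) : HasFDerivAt (fun x => A x + y) A x := A.hasFDerivAt.add_const y
  -- Integration by parts in direction `e j` removes the factor `x j`.
  have hfirst (i j : Fin n) :
      ∫ x, g (A x + y) * x i * x j ∂(stdGaussian n) =
        ∫ x, (fderiv ℝ g (A x + y) (A (e j)) * x i +
          g (A x + y) * (1 : Matrix (Fin n) (Fin n) ℝ) i j) ∂(stdGaussian n) := by
    let P : EuclideanSpace ℝ (Fin n) →L[ℝ] ℝ := EuclideanSpace.proj i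
    have hd (x) := ((hg.differentiable (by norm_num) _).hasFDerivAt.comp x (haff x)).mul
      P.hasFDerivAt
    have hval (x : EuclideanSpace ℝ (Fin n)) :
        (g (A x + y) • P +
          x i • (fderiv ℝ g (A x + y)).comp A) (e j) =
        fderiv ℝ g (A x + y) (A (e j)) * x i +
          g (A x + y) * (1 : Matrix (Fin n) (Fin n) ℝ) i j := by
      simp [P, e, Matrix.one_apply]
      ring
    have h := integral_mul_inner_stdGaussian (f := fun x => g (A x + y) * x i) (e j) hd
      ((hpg.mul (hpx i)).integrable_stdGaussian (by fun_prop))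
      (by simpa only [hinner] using hgx i j)
      (((hdx (A (e j)) i).add (hgi.mul_const _)).congr
        (Filter.Eventually.of_forall fun x => (hval x).symm))
    simp only [hinner] at h
    exact h.trans (integral_congr_ae (Filter.Eventually.of_forall hval))
  have hsecond (i j : Fin n) :
      ∫ x, fderiv ℝ g (A x + y) (A (e j)) * x i ∂(stdGaussian n) =
        ∫ x, (Λᵀ * hessian g (A x + y) * Λ) i j ∂(stdGaussian n) := by
    have hd (x) := ((hdg.differentiable (by norm_num) _).hasFDerivAt.comp x (haff x)).clm_apply
      (hasFDerivAt_const (A (e j)) x)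
    have hval (x : EuclideanSpace ℝ (Fin n)) :
        fderiv ℝ (fderiv ℝ g) (A x + y) (A (e i)) (A (e j)) =
          (Λᵀ * hessian g (A x + y) * Λ) i j :=
      fderiv_fderiv_toEuclideanLin_single hg Λ _ i j
    have hint : Integrable (fun x => (Λᵀ * hessian g (A x + y) * Λ) i j) (stdGaussian n) := by
      simp only [Matrix.mul_apply]
      exact integrable_finsetSum _ fun l _ => (integrable_finsetSum _ fun k _ =>
        (hHess k l).const_mul _).mul_const _
    have h := integral_mul_inner_stdGaussian
      (f := fun x => fderiv ℝ g (A x + y) (A (e j))) (e i) hd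
      ((hpdg _).integrable_stdGaussian (hcdg _))
      (by simpa only [hinner] using hdx (A (e j)) i)
      (by simpa [hval] using hint)
    simpa [hinner, hval] using h
  ext i j
  have hL (i j : Fin n) : Integrable (fun x => (g (A x + y) •
      ((Matrix.of fun i j => x i * x j) - (1 : Matrix (Fin n) (Fin n) ℝ))) i j)
      (stdGaussian n) := by
    refine ((hgx i j).sub (hgi.mul_const ((1 : Matrix (Fin n) (Fin n) ℝ) i j))).congr
      (Filter.Eventually.of_forall fun x => ?_)
    simp
    ring
  rw [integral_matrix_apply hL]
  calc _ = ∫ x, (g (A x + y) * x i * x j -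
          g (A x + y) * (1 : Matrix (Fin n) (Fin n) ℝ) i j) ∂(stdGaussian n) := by
        refine integral_congr_ae (Filter.Eventually.of_forall fun x => ?_)
        simp
        ring
    _ = ∫ x, fderiv ℝ g (A x + y) (A (e j)) * x i ∂(stdGaussian n) := by
        rw [integral_sub (hgx i j) (hgi.mul_const _), hfirst,
          integral_add (hdx _ _) (hgi.mul_const _), add_sub_cancel_right]
    _ = ∫ x, (Λᵀ * hessian g (A x + y) * Λ) i j ∂(stdGaussian n) := hsecond i j
    _ = _ := by
        simp only [Matrix.mul_apply, integral_matrix_apply hHess]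
        rw [integral_finsetSum _ fun l _ => (integrable_finsetSum _ fun k _ =>
          (hHess k l).const_mul _).mul_const _]
        refine Finset.sum_congr rfl fun l _ => ?_
        rw [integral_mul_const, integral_finsetSum _ fun k _ => (hHess k l).const_mul _]
        simp only [integral_const_mul]
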